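/- Let n ≥ 2 and δ ∈ (0,1), and for ε ∈ (0,1) set U_ε = B_1 \ closure(B_{1−ε}) ⊂ ℝ^{2n}. Let r > 0 and let φ be a symplectic embedding of an open neighborhood of rA_δ into U_ε such that the bounded connected component of ℝ^{2n} \ φ(S_r^{2n−1}) is contained in U_ε. Then r² < (1 − (1−ε)^{2n})^{1/n}. -/

import Mathlib

open Metric Set MeasureTheory Real Filter Topology Bornology
open scoped ContDiff ENNReal

noncomputable section

/-- `ℝ^{2n}` with the Euclidean structure. -/
abbrev R2n (n : ℕ) := EuclideanSpace ℝ (Fin (2 * n))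

/-- The standard symplectic form `ω_st = Σ dx_i ∧ dy_i` on `ℝ^{2n}`,
evaluated on a pair of (tangent) vectors. -/
def sympForm (n : ℕ) (v w : R2n n) : ℝ :=
  ∑ i : Fin n,
    (v ⟨2 * i.1, by have := i.isLt; omega⟩ * w ⟨2 * i.1 + 1, by have := i.isLt; omega⟩ -
      v ⟨2 * i.1 + 1, by have := i.isLt; omega⟩ * w ⟨2 * i.1, by have := i.isLt; omega⟩)

/-- `φ` is a symplectic embedding of the open set `N ⊆ ℝ^{2n}` into `U ⊆ ℝ^{2n}`:
a smooth injective map on `N` with image in `U` whose derivative preserves `ω_st`. -/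
def IsSympEmbOn (n : ℕ) (N U : Set (R2n n)) (φ : R2n n → R2n n) : Prop :=
  IsOpen N ∧ ContDiffOn ℝ ∞ φ N ∧ InjOn φ N ∧ MapsTo φ N U ∧
    ∀ p ∈ N, ∀ v w : R2n n,
      sympForm n (fderiv ℝ φ p v) (fderiv ℝ φ p w) = sympForm n v w

/-- A symplectic embedding of (a neighbourhood of) an arbitrary set `A ⊆ ℝ^{2n}` into `U`. -/
def SympEmbNbhd (n : ℕ) (A U : Set (R2n n)) : Prop :=
  ∃ N φ, A ⊆ N ∧ IsSympEmbOn n N U φ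

/-- The spherical capacity `s(U)`. -/
def sphericalCap (n : ℕ) (U : Set (R2n n)) : ℝ≥0∞ :=
  sSup {c : ℝ≥0∞ | ∃ r : ℝ, 0 < r ∧ c = ENNReal.ofReal (π * r ^ 2) ∧
    SympEmbNbhd n (sphere (0 : R2n n) r) U}

/-- The quadratic form defining the ellipsoid with symplectic half axes `a i`. -/
def ellQ (n : ℕ) (a : Fin n → ℝ) (z : R2n n) : ℝ :=
  ∑ i : Fin n,
    ((z ⟨2 * i.1, by have := i.isLt; omega⟩) ^ 2 +
      (z ⟨2 * i.1 + 1, by have := i.isLt; omega⟩) ^ 2) / (a i) ^ 2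

/-- The open ellipsoid `E(a 0, …, a (n-1)) ⊆ ℝ^{2n}`. -/
def ellipsoid (n : ℕ) (a : Fin n → ℝ) : Set (R2n n) := {z | ellQ n a z < 1}

/-- The boundary `∂E(a 0, …, a (n-1)) ⊆ ℝ^{2n}` of an ellipsoid. -/
def ellipsoidBdry (n : ℕ) (a : Fin n → ℝ) : Set (R2n n) := {z | ellQ n a z = 1}

/-- The ellipsoidal shell `U_ε = (1+ε)E \ closure((1-ε)E)`. -/
def ellShell (n : ℕ) (a : Fin n → ℝ) (ε : ℝ) : Set (R2n n) :=
  ellipsoid n (fun i => (1 + ε) * a i) \ closure (ellipsoid n (fun i => (1 - ε) * a i))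

/-- The `δ`-shell capacity `c_δ(U)`, defined via embeddings of the closed
shells `r A_δ = closure(B_r) \ B_{r(1-δ)}`. -/
def shellCap (n : ℕ) (δ : ℝ) (U : Set (R2n n)) : ℝ≥0∞ :=
  sSup {c : ℝ≥0∞ | ∃ r : ℝ, 0 < r ∧ c = ENNReal.ofReal (π * r ^ 2) ∧
    SympEmbNbhd n (closedBall (0 : R2n n) r \ ball 0 (r * (1 - δ))) U}

/-- The ellipsoidal capacity `e(U)`: the supremum of `π r₁²` over symplectic embeddings of
boundaries of ellipsoids with half axes `r₁ ≤ … ≤ r_n` (here `r₁ = ⨅ i, a i`). -/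
def ellipsoidalCap (n : ℕ) (U : Set (R2n n)) : ℝ≥0∞ :=
  sSup {c : ℝ≥0∞ | ∃ a : Fin n → ℝ, (∀ i, 0 < a i) ∧ Monotone a ∧
    c = ENNReal.ofReal (π * (⨅ i, a i) ^ 2) ∧ SympEmbNbhd n (ellipsoidBdry n a) U}

/-- The Gromov radius `c_B(U)`. -/
def gromovRadius (n : ℕ) (U : Set (R2n n)) : ℝ≥0∞ :=
  sSup {c : ℝ≥0∞ | ∃ r : ℝ, 0 < r ∧ c = ENNReal.ofReal (π * r ^ 2) ∧
    ∃ φ, IsSympEmbOn n (ball (0 : R2n n) r) U φ}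


open scoped InnerProductSpace

section ComplexStructure

variable {E : Type*} [NormedAddCommGroup E] [InnerProductSpace ℝ E]

/-- Green's formula for the area `⟪J u, du⟫` swept by a map of a rectangle. -/
lemma integral_area_form_eq_boundary (J : E →L[ℝ] E) (hJ : ∀ v w, ⟪J v, w⟫_ℝ = -⟪v, J w⟫_ℝ)
    (U : ℝ × ℝ → E) (hU : ContDiff ℝ 2 U) (S T : ℝ) :
    ∫ s in (0 : ℝ)..S, ∫ t in (0 : ℝ)..T,
      2 * ⟪J (fderiv ℝ U (s, t) (1, 0)), fderiv ℝ U (s, t) (0, 1)⟫_ℝ =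
    (((∫ s in (0 : ℝ)..S, -⟪J (U (s, T)), fderiv ℝ U (s, T) (1, 0)⟫_ℝ) -
      ∫ s in (0 : ℝ)..S, -⟪J (U (s, 0)), fderiv ℝ U (s, 0) (1, 0)⟫_ℝ) +
      ∫ t in (0 : ℝ)..T, ⟪J (U (S, t)), fderiv ℝ U (S, t) (0, 1)⟫_ℝ) -
      ∫ t in (0 : ℝ)..T, ⟪J (U (0, t)), fderiv ℝ U (0, t) (0, 1)⟫_ℝ := by
  have hdU : ContDiff ℝ 1 (fderiv ℝ U) := hU.fderiv_right (by norm_num)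
  have hd (v : ℝ × ℝ) : ContDiff ℝ 1 (fun p => ⟪J (U p), fderiv ℝ U p v⟫_ℝ) :=
    (J.contDiff.comp (hU.of_le (by norm_num))).inner ℝ (hdU.clm_apply contDiff_const)
  have hderiv (v w p : ℝ × ℝ) : fderiv ℝ (fun p => ⟪J (U p), fderiv ℝ U p v⟫_ℝ) p w =
      ⟪J (U p), fderiv ℝ (fderiv ℝ U) p w v⟫_ℝ + ⟪J (fderiv ℝ U p w), fderiv ℝ U p v⟫_ℝ := by
    have h1 : HasFDerivAt (fun p => J (U p)) (J.comp (fderiv ℝ U p)) p :=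
      J.hasFDerivAt.comp p (hU.differentiable (by norm_num) p).hasFDerivAt
    have h2 : HasFDerivAt (fun p => fderiv ℝ U p v) ((fderiv ℝ (fderiv ℝ U) p).flip v) p := by
      simpa using (hdU.differentiable (by norm_num) p).hasFDerivAt.clm_apply
        (hasFDerivAt_const v p)
    rw [(h1.inner ℝ h2).fderiv]
    simp
  have hsymm (p : ℝ × ℝ) : fderiv ℝ (fderiv ℝ U) p (1, 0) (0, 1) =
      fderiv ℝ (fderiv ℝ U) p (0, 1) (1, 0) :=
    hU.contDiffAt.isSymmSndFDerivAt (by simp) _ _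
  have key := integral2_divergence_prod_of_hasFDerivAt
    (fun p => ⟪J (U p), fderiv ℝ U p (0, 1)⟫_ℝ) (fun p => -⟪J (U p), fderiv ℝ U p (1, 0)⟫_ℝ)
    (fderiv ℝ fun p => ⟪J (U p), fderiv ℝ U p (0, 1)⟫_ℝ)
    (fun p => -fderiv ℝ (fun p => ⟪J (U p), fderiv ℝ U p (1, 0)⟫_ℝ) p) 0 0 S T
    (hd _).continuous.continuousOn (hd _).continuous.neg.continuousOn
    (fun p _ => ((hd _).differentiable (by norm_num) p).hasFDerivAt)
    (fun p _ => ((hd _).differentiable (by norm_num) p).hasFDerivAt.neg)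
    (by
      refine ContinuousOn.integrableOn_compact (isCompact_uIcc.prod isCompact_uIcc) ?_
      refine Continuous.continuousOn (Continuous.add ?_ ?_)
      · exact ((hd _).continuous_fderiv (by norm_num)).clm_apply continuous_const
      · exact ((hd _).continuous_fderiv (by norm_num)).neg.clm_apply continuous_const)
  rw [← key]
  refine intervalIntegral.integral_congr fun s _ => intervalIntegral.integral_congr fun t _ => ?_
  have hneg : ⟪J (fderiv ℝ U (s, t) (0, 1)), fderiv ℝ U (s, t) (1, 0)⟫_ℝ =
      -⟪J (fderiv ℝ U (s, t) (1, 0)), fderiv ℝ U (s, t) (0, 1)⟫_ℝ := by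
    rw [hJ, real_inner_comm]
  simp only [neg_apply, hderiv, hneg, hsymm]
  ring

/-- A map of an annulus of circles, constant on the last circle, sweeps out the area enclosed by
the first. -/
lemma integral_circle_eq_neg_integral_area (J : E →L[ℝ] E)
    (hJ : ∀ v w, ⟪J v, w⟫_ℝ = -⟪v, J w⟫_ℝ)
    (U : ℝ × ℝ → E) (hU : ContDiff ℝ 2 U) (S T : ℝ)
    (hper : ∀ s t, U (s, t + T) = U (s, t)) (hconst : ∀ t, U (S, t) = U (S, 0)) :
    ∫ t in (0 : ℝ)..T, ⟪J (U (0, t)), fderiv ℝ U (0, t) (0, 1)⟫_ℝ =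
      -∫ s in (0 : ℝ)..S, ∫ t in (0 : ℝ)..T,
        2 * ⟪J (fderiv ℝ U (s, t) (1, 0)), fderiv ℝ U (s, t) (0, 1)⟫_ℝ := by
  have hperd (s : ℝ) : fderiv ℝ U (s, T) = fderiv ℝ U (s, 0) := by
    have : (fun p : ℝ × ℝ => U (p + (0, T))) = U := by
      ext ⟨a, b⟩
      simpa using hper a b
    rw [← congrArg (fun V => fderiv ℝ V (s, (0 : ℝ))) this]
    simp [fderiv_comp_add_right]
  have hperU (s : ℝ) : U (s, T) = U (s, 0) := by simpa using hper s 0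
  have hzero (t : ℝ) : fderiv ℝ U (S, t) (0, 1) = 0 := by
    have h1 : HasDerivAt (fun τ : ℝ => U (S, τ)) (fderiv ℝ U (S, t) (0, 1)) t :=
      ((hU.differentiable (by norm_num) (S, t)).hasFDerivAt).comp_hasDerivAt t
        ((hasDerivAt_const t S).prodMk (hasDerivAt_id t))
    have h2 : HasDerivAt (fun τ : ℝ => U (S, τ)) 0 t := by
      simp only [hconst]
      exact hasDerivAt_const t _
    exact h1.unique h2
  rw [integral_area_form_eq_boundary J hJ U hU]
  simp [hperd, hperU, hzero]

end ComplexStructure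

section HopfCircles

variable {E : Type*} [NormedAddCommGroup E] [InnerProductSpace ℝ E]

/-- `f` is smooth on `N` and its derivatives there preserve the form `⟪J v, w⟫`. -/
structure PreservesFormOn (J : E →L[ℝ] E) (f : E → E) (N : Set E) : Prop where
  isOpen : IsOpen N
  contDiffOn : ContDiffOn ℝ ∞ f N
  inner_fderiv : ∀ p ∈ N, ∀ v w, ⟪J (fderiv ℝ f p v), fderiv ℝ f p w⟫_ℝ = ⟪J v, w⟫_ℝ

/-- An orthogonal complex structure. -/
structure IsOrthogonalComplexStructure (J : E →L[ℝ] E) : Prop where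
  apply_apply : ∀ v, J (J v) = -v
  inner_left : ∀ v w, ⟪J v, w⟫_ℝ = -⟪v, J w⟫_ℝ

namespace IsOrthogonalComplexStructure

variable {J : E →L[ℝ] E}

lemma inner_map_map (hJ : IsOrthogonalComplexStructure J) (v w : E) :
    ⟪J v, J w⟫_ℝ = ⟪v, w⟫_ℝ := by
  rw [hJ.inner_left, hJ.apply_apply, inner_neg_right, neg_neg]

lemma inner_self (hJ : IsOrthogonalComplexStructure J) (v : E) : ⟪J v, v⟫_ℝ = 0 := by
  have h := hJ.inner_left v v
  rw [real_inner_comm v (J v)] at h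
  rw [real_inner_comm]
  linarith

lemma norm_map (hJ : IsOrthogonalComplexStructure J) (v : E) : ‖J v‖ = ‖v‖ := by
  have h := hJ.inner_map_map v v
  simp only [real_inner_self_eq_norm_sq] at h
  exact (sq_eq_sq₀ (norm_nonneg _) (norm_nonneg _)).mp h

end IsOrthogonalComplexStructure

/-- The rotation `exp (t J)`. -/
def hopfRotation (J : E →L[ℝ] E) (t : ℝ) (z : E) : E := cos t • z + sin t • J z

variable {J : E →L[ℝ] E}

lemma norm_cos_smul_add_sin_smul {z w : E} (h : ‖w‖ = ‖z‖) (hzw : ⟪z, w⟫_ℝ = 0) (s : ℝ) :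
    ‖cos s • z + sin s • w‖ = ‖z‖ := by
  have : ‖cos s • z + sin s • w‖ ^ 2 = ‖z‖ ^ 2 := by
    rw [norm_add_sq_real, norm_smul, norm_smul, inner_smul_left, inner_smul_right, hzw, h,
      mul_pow, mul_pow, norm_eq_abs, norm_eq_abs, sq_abs, sq_abs]
    linear_combination ‖z‖ ^ 2 * sin_sq_add_cos_sq s
  exact (sq_eq_sq₀ (norm_nonneg _) (norm_nonneg _)).mp this

lemma norm_hopfRotation (hJ : IsOrthogonalComplexStructure J) (t : ℝ) (z : E) :
    ‖hopfRotation J t z‖ = ‖z‖ :=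
  norm_cos_smul_add_sin_smul (hJ.norm_map z) (by rw [real_inner_comm, hJ.inner_self]) t

lemma map_hopfRotation (hJ : IsOrthogonalComplexStructure J) (t : ℝ) (z : E) :
    J (hopfRotation J t z) = -sin t • z + cos t • J z := by
  simp only [hopfRotation, map_add, map_smul, hJ.apply_apply]
  module

/-- The integral of the primitive of the symplectic form over the image of a Hopf circle is the
same as over the Hopf circle itself. -/
lemma integral_hopf_circle (hJ : IsOrthogonalComplexStructure J) {N : Set E} {f : E → E}
    (hf : PreservesFormOn J f N) {z w : E} (hN : sphere 0 ‖z‖ ⊆ N) (hw : ‖w‖ = ‖z‖)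
    (hzw : ⟪z, w⟫_ℝ = 0) (hJzw : ⟪J z, w⟫_ℝ = 0) :
    ∫ t in (0 : ℝ)..2 * π, ⟪J (f (hopfRotation J t z)),
      fderiv ℝ f (hopfRotation J t z) (J (hopfRotation J t z))⟫_ℝ = 2 * π * ‖z‖ ^ 2 := by
  set G : ℝ × ℝ → E := fun p => cos p.1 • (cos p.2 • z + sin p.2 • J z) + sin p.1 • w with hG
  have hGsmooth : ContDiff ℝ 2 G := by
    have h1 : ContDiff ℝ 2 (fun p : ℝ × ℝ => cos p.1) := contDiff_cos.comp contDiff_fst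
    have h2 : ContDiff ℝ 2 (fun p : ℝ × ℝ => cos p.2) := contDiff_cos.comp contDiff_snd
    have h3 : ContDiff ℝ 2 (fun p : ℝ × ℝ => sin p.1) := contDiff_sin.comp contDiff_fst
    have h4 : ContDiff ℝ 2 (fun p : ℝ × ℝ => sin p.2) := contDiff_sin.comp contDiff_snd
    exact (h1.smul ((h2.smul contDiff_const).add (h4.smul contDiff_const))).add
      (h3.smul contDiff_const)
  have hGN (p : ℝ × ℝ) : G p ∈ N := by
    refine hN ?_
    have h := norm_hopfRotation hJ p.2 z
    rw [hopfRotation] at h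
    rw [mem_sphere_zero_iff_norm, hG, ← h]
    refine norm_cos_smul_add_sin_smul (by rw [h, hw]) ?_ _
    simp [inner_add_left, inner_smul_left, hzw, hJzw]
  have hfG : ContDiff ℝ 2 (f ∘ G) := by
    rw [contDiff_iff_contDiffAt]
    intro p
    exact ((hf.contDiffOn.contDiffAt (hf.isOpen.mem_nhds (hGN p))).of_le
      (WithTop.coe_le_coe.mpr (le_top : (2 : ℕ∞) ≤ ⊤))).comp p hGsmooth.contDiffAt
  have hper (s t : ℝ) : G (s, t + 2 * π) = G (s, t) := by simp [hG]
  have hconst (t : ℝ) : G (π / 2, t) = G (π / 2, 0) := by simp [hG]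
  have hG0 (t : ℝ) : G (0, t) = hopfRotation J t z := by simp [hG, hopfRotation]
  have hGt (t : ℝ) : fderiv ℝ G (0, t) (0, 1) = J (hopfRotation J t z) := by
    have h1 : HasDerivAt (fun τ : ℝ => G (0, τ)) (fderiv ℝ G (0, t) (0, 1)) t :=
      ((hGsmooth.differentiable (by norm_num) (0, t)).hasFDerivAt).comp_hasDerivAt t
        ((hasDerivAt_const t 0).prodMk (hasDerivAt_id t))
    have h2 : HasDerivAt (fun τ : ℝ => G (0, τ)) (J (hopfRotation J t z)) t := by
      simp only [hG0, map_hopfRotation hJ]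
      exact ((hasDerivAt_cos t).smul_const z).add ((hasDerivAt_sin t).smul_const (J z))
    exact h1.unique h2
  have hchain (p v : ℝ × ℝ) : fderiv ℝ (f ∘ G) p v = fderiv ℝ f (G p) (fderiv ℝ G p v) := by
    rw [fderiv_comp]
    · rfl
    · exact (hf.contDiffOn.contDiffAt (hf.isOpen.mem_nhds (hGN p))).differentiableAt (by simp)
    · exact hGsmooth.differentiable (by norm_num) p
  have e1 := integral_circle_eq_neg_integral_area J hJ.inner_left G hGsmooth (π / 2) (2 * π)
    hper hconst
  have e2 := integral_circle_eq_neg_integral_area J hJ.inner_left (f ∘ G) hfG (π / 2) (2 * π)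
    (fun s t => congrArg f (hper s t)) (fun t => congrArg f (hconst t))
  simp only [hchain, hf.inner_fderiv _ (hGN _)] at e2
  rw [← e1] at e2
  simp only [Function.comp_apply, hG0, hGt, real_inner_self_eq_norm_sq, hJ.norm_map,
    norm_hopfRotation hJ] at e2
  simpa using e2

/-- In dimension at least three there is a vector of prescribed length orthogonal to `z, J z`. -/
lemma exists_norm_eq_orthogonal [FiniteDimensional ℝ E] (hE : 3 ≤ Module.finrank ℝ E)
    (J : E →L[ℝ] E) (z : E) : ∃ w : E, ‖w‖ = ‖z‖ ∧ ⟪z, w⟫_ℝ = 0 ∧ ⟪J z, w⟫_ℝ = 0 := by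
  have h1 : Module.finrank ℝ (Submodule.span ℝ ({z, J z} : Set E)) ≤ 2 := by
    classical
    have := finrank_span_finset_le_card (R := ℝ) ({z, J z} : Finset E)
    simp only [Finset.coe_insert, Finset.coe_singleton] at this
    exact this.trans Finset.card_le_two
  have h2 := (Submodule.span ℝ ({z, J z} : Set E)).finrank_add_finrank_orthogonal
  have h3 : (Submodule.span ℝ ({z, J z} : Set E))ᗮ ≠ ⊥ := by
    intro h
    rw [h, finrank_bot] at h2
    omega
  obtain ⟨w, hw, hw0⟩ := Submodule.exists_mem_ne_zero_of_ne_bot h3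
  rw [Submodule.mem_orthogonal] at hw
  refine ⟨(‖z‖ / ‖w‖) • w, ?_, ?_, ?_⟩
  · rw [norm_smul, norm_div, norm_norm, norm_norm, div_mul_cancel₀ _ (norm_ne_zero_iff.mpr hw0)]
  · rw [inner_smul_right, hw _ (Submodule.subset_span (by simp)), mul_zero]
  · rw [inner_smul_right, hw _ (Submodule.subset_span (by simp)), mul_zero]

end HopfCircles

section Averaging

variable {E : Type*} [NormedAddCommGroup E] [InnerProductSpace ℝ E] [FiniteDimensional ℝ E]

/-- A linear map preserving the symplectic form has determinant `±1`. -/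
lemma abs_det_eq_one_of_preserves_form {J : E →L[ℝ] E} (hJ : IsOrthogonalComplexStructure J)
    (M : E →L[ℝ] E) (hM : ∀ v w, ⟪J (M v), M w⟫_ℝ = ⟪J v, w⟫_ℝ) : |M.det| = 1 := by
  have hcomp : (LinearMap.adjoint (M : E →ₗ[ℝ] E)) ∘ₗ (J : E →ₗ[ℝ] E) ∘ₗ (M : E →ₗ[ℝ] E) =
      (J : E →ₗ[ℝ] E) := by
    ext v
    refine ext_inner_right ℝ fun w => ?_
    simpa [LinearMap.adjoint_inner_left] using hM v w
  have hadj : LinearMap.det (LinearMap.adjoint (M : E →ₗ[ℝ] E)) =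
      LinearMap.det (M : E →ₗ[ℝ] E) := by
    rw [← LinearMap.det_toMatrix (stdOrthonormalBasis ℝ E).toBasis,
      ← LinearMap.det_toMatrix (stdOrthonormalBasis ℝ E).toBasis,
      LinearMap.toMatrix_adjoint, Matrix.det_conjTranspose, star_trivial]
  have hJJ : (J : E →ₗ[ℝ] E) ∘ₗ (J : E →ₗ[ℝ] E) = (-1 : ℝ) • LinearMap.id := by
    ext v
    simp [hJ.apply_apply]
  have hJ0 : LinearMap.det (J : E →ₗ[ℝ] E) ≠ 0 := by
    intro h
    have := congrArg LinearMap.det hJJ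
    rw [LinearMap.det_comp, h, LinearMap.det_smul, LinearMap.det_id,
      mul_zero, mul_one] at this
    exact pow_ne_zero _ (by norm_num) this.symm
  have h := congrArg LinearMap.det hcomp
  rw [LinearMap.det_comp, LinearMap.det_comp, hadj] at h
  have h2 : M.det * M.det = 1 := by
    refine mul_right_cancel₀ hJ0 ?_
    rw [one_mul]
    linear_combination h
  rw [← abs_one, ← sq_eq_sq_iff_abs_eq_abs]
  linarith

variable [MeasurableSpace E] [BorelSpace E]

/-- Partial integration against the Euler vector field. -/
lemma integral_fderiv_apply_self (g : E → ℝ) (hg : ContDiff ℝ 1 g) (hc : HasCompactSupport g) :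
    ∫ y, fderiv ℝ g y y = -(Module.finrank ℝ E : ℝ) * ∫ y, g y := by
  set b := stdOrthonormalBasis ℝ E
  have hcont (i) : Continuous fun y => fderiv ℝ g y (b i) :=
    (hg.continuous_fderiv (by norm_num)).clm_apply continuous_const
  have hinner (i) : Continuous fun y : E => ⟪b i, y⟫_ℝ := by fun_prop
  have hsupp (i) : HasCompactSupport fun y => fderiv ℝ g y (b i) := hc.fderiv_apply ℝ (b i)
  have hint (i) : Integrable fun y => ⟪b i, y⟫_ℝ * fderiv ℝ g y (b i) :=
    ((hinner i).mul (hcont i)).integrable_of_hasCompactSupport (hsupp i).mul_left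
  have hfd (i) (y : E) : fderiv ℝ (fun y : E => ⟪b i, y⟫_ℝ) y (b i) = 1 := by
    have : HasFDerivAt (fun y : E => ⟪b i, y⟫_ℝ) (innerSL ℝ (b i)) y :=
      (innerSL ℝ (b i)).hasFDerivAt
    rw [this.fderiv]
    simp
  have hpart (i) : ∫ y, ⟪b i, y⟫_ℝ * fderiv ℝ g y (b i) = -∫ y, g y := by
    rw [integral_mul_fderiv_eq_neg_fderiv_mul_of_integrable]
    · simp [hfd]
    · simpa [hfd] using hg.continuous.integrable_of_hasCompactSupport hc
    · exact hint i
    · exact ((hinner i).mul hg.continuous).integrable_of_hasCompactSupport hc.mul_left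
    · exact fun y _ => (innerSL ℝ (b i)).differentiableAt
    · exact fun y _ => hg.differentiable (by norm_num) y
  have hexp (y : E) : fderiv ℝ g y y = ∑ i, ⟪b i, y⟫_ℝ * fderiv ℝ g y (b i) := by
    conv_lhs => rw [← b.sum_repr' y]
    simp only [map_sum, map_smul, smul_eq_mul]
    rw [b.sum_repr' y]
  simp_rw [hexp]
  rw [integral_finsetSum _ fun i _ => hint i]
  simp [hpart]

lemma integral_comp_hopfRotation {J : E →L[ℝ] E} (hJ : IsOrthogonalComplexStructure J)
    (F : E → ℝ) (t : ℝ) : ∫ z, F (hopfRotation J t z) = ∫ z, F z := by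
  let L : E →ₗᵢ[ℝ] E :=
    { toLinearMap := cos t • LinearMap.id + sin t • (J : E →ₗ[ℝ] E)
      norm_map' := fun z => norm_hopfRotation hJ t z }
  let e := L.toLinearIsometryEquiv rfl
  exact e.measurePreserving.integral_comp e.toHomeomorph.measurableEmbedding F

/-- Averaging along Hopf circles of a radially weighted action density. -/
lemma integral_radial_mul_action {J : E →L[ℝ] E} (hJ : IsOrthogonalComplexStructure J)
    (hE : 3 ≤ Module.finrank ℝ E) {N : Set E} {f : E → E} (hf : PreservesFormOn J f N)
    {c : ℝ → ℝ} (hc : Continuous c) {p q : ℝ} (hcz : ∀ t, t ∉ Icc p q → c t = 0)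
    (hN : ∀ z : E, ‖z‖ ^ 2 ∈ Icc p q → z ∈ N) :
    ∫ z, c (‖z‖ ^ 2) * ⟪J (f z), fderiv ℝ f z (J z)⟫_ℝ = ∫ z : E, c (‖z‖ ^ 2) * ‖z‖ ^ 2 := by
  set F : E → ℝ := fun z => c (‖z‖ ^ 2) * ⟪J (f z), fderiv ℝ f z (J z)⟫_ℝ with hF
  have hF0 (z : E) (hz : ‖z‖ ^ 2 ∉ Icc p q) : F z = 0 := by simp [hF, hcz _ hz]
  have hFc : Continuous F := by
    rw [continuous_iff_continuousAt]
    intro z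
    by_cases hz : ‖z‖ ^ 2 ∈ Icc p q
    · have hzN := hf.isOpen.mem_nhds (hN z hz)
      have h1 : ContinuousAt f z := hf.contDiffOn.continuousOn.continuousAt hzN
      have h2 : ContinuousAt (fderiv ℝ f) z :=
        (hf.contDiffOn.continuousOn_fderiv_of_isOpen hf.isOpen (by simp)).continuousAt hzN
      have h3 : ContinuousAt (fun z : E => c (‖z‖ ^ 2)) z := by fun_prop
      exact h3.mul ((J.continuous.continuousAt.comp h1).inner
        (h2.clm_apply J.continuous.continuousAt))
    · have ho : IsOpen {z : E | ‖z‖ ^ 2 ∉ Icc p q} :=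
        (isClosed_Icc.preimage (f := fun z : E => ‖z‖ ^ 2) (by fun_prop)).isOpen_compl
      refine (continuousAt_const (y := (0 : ℝ))).congr ?_
      filter_upwards [ho.mem_nhds hz] with y hy
      exact (hF0 y hy).symm
  have hrot : Continuous fun x : ℝ × E => hopfRotation J x.1 x.2 := by
    unfold hopfRotation
    fun_prop
  have hint : Integrable (Function.uncurry fun (t : ℝ) (z : E) => F (hopfRotation J t z))
      ((volume.restrict (Ioc 0 (2 * π))).prod volume) := by
    have h : IntegrableOn (Function.uncurry fun (t : ℝ) (z : E) => F (hopfRotation J t z))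
        (Ioc 0 (2 * π) ×ˢ univ) (volume.prod volume) := by
      refine IntegrableOn.of_forall_sdiff_eq_zero
        (s := Icc 0 (2 * π) ×ˢ closedBall (0 : E) √q) ?_
        (measurableSet_Ioc.prod MeasurableSet.univ) ?_
      · exact (hFc.comp hrot).continuousOn.integrableOn_compact
          (isCompact_Icc.prod (isCompact_closedBall _ _))
      · rintro ⟨t, z⟩ ⟨h1, h2⟩
        refine hF0 _ fun h => h2 ⟨Ioc_subset_Icc_self h1.1, ?_⟩
        rw [norm_hopfRotation hJ] at h
        rw [mem_closedBall_zero_iff]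
        exact Real.le_sqrt_of_sq_le h.2
    rwa [IntegrableOn, ← Measure.prod_restrict, Measure.restrict_univ] at h
  have hcircle (z : E) : ∫ t in (0 : ℝ)..2 * π, F (hopfRotation J t z) =
      2 * π * (c (‖z‖ ^ 2) * ‖z‖ ^ 2) := by
    simp only [hF, norm_hopfRotation hJ]
    rw [intervalIntegral.integral_const_mul]
    by_cases hz : ‖z‖ ^ 2 ∈ Icc p q
    · obtain ⟨w, hw, hzw, hJzw⟩ := exists_norm_eq_orthogonal hE J z
      rw [integral_hopf_circle hJ hf (fun y hy => hN y ?_) hw hzw hJzw]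
      · ring
      · rwa [mem_sphere_zero_iff_norm.mp hy]
    · simp [hcz _ hz]
  have hpi : (0 : ℝ) < 2 * π := by positivity
  have h1 : ∫ t in Ioc 0 (2 * π), ∫ z, F (hopfRotation J t z) = 2 * π * ∫ z, F z := by
    simp [integral_comp_hopfRotation hJ, hpi.le]
  have h2 : ∫ z : E, ∫ t in Ioc 0 (2 * π), F (hopfRotation J t z) =
      2 * π * ∫ z : E, c (‖z‖ ^ 2) * ‖z‖ ^ 2 := by
    rw [← integral_const_mul]
    refine integral_congr_ae (Eventually.of_forall fun z => ?_)
    simp only [← hcircle, intervalIntegral.integral_of_le hpi.le]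
  rw [integral_integral_swap hint, h2] at h1
  exact (mul_left_cancel₀ hpi.ne' h1).symm

end Averaging

section VolumeComparison

variable {E : Type*} [NormedAddCommGroup E] [InnerProductSpace ℝ E] [FiniteDimensional ℝ E]

/-- The derivative of a form-preserving map, as a continuous linear equivalence. -/
lemma PreservesFormOn.exists_equiv {J : E →L[ℝ] E} (hJ : IsOrthogonalComplexStructure J)
    {N : Set E} {f : E → E} (hf : PreservesFormOn J f N) {z : E} (hz : z ∈ N) :
    ∃ M : E ≃L[ℝ] E, (M : E →L[ℝ] E) = fderiv ℝ f z ∧ HasFDerivAt f (M : E →L[ℝ] E) z := by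
  have hdet : (fderiv ℝ f z).det ≠ 0 := by
    intro h
    have := abs_det_eq_one_of_preserves_form hJ _ (hf.inner_fderiv z hz)
    rw [h] at this
    simp at this
  refine ⟨(fderiv ℝ f z).toContinuousLinearEquivOfDetNeZero hdet, by ext; simp, ?_⟩
  rw [ContinuousLinearMap.coe_toContinuousLinearEquivOfDetNeZero]
  exact ((hf.contDiffOn.contDiffAt (hf.isOpen.mem_nhds hz)).differentiableAt (by simp)).hasFDerivAt

lemma PreservesFormOn.isOpen_image {J : E →L[ℝ] E} (hJ : IsOrthogonalComplexStructure J)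
    {N : Set E} {f : E → E} (hf : PreservesFormOn J f N) {s : Set E} (hs : IsOpen s)
    (hsN : s ⊆ N) : IsOpen (f '' s) := by
  rw [isOpen_iff_mem_nhds]
  rintro _ ⟨z, hz, rfl⟩
  obtain ⟨M, -, hM⟩ := hf.exists_equiv hJ (hsN hz)
  have h := (hf.contDiffOn.contDiffAt (hf.isOpen.mem_nhds (hsN hz))).hasStrictFDerivAt' hM
    (by simp)
  rw [← h.map_nhds_eq_of_equiv]
  exact image_mem_map (hs.mem_nhds hz)

/-- If `g ∘ f` is smooth on an open set, then `g` is smooth at the points of its image. -/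
lemma PreservesFormOn.contDiffAt_of_comp {J : E →L[ℝ] E} (hJ : IsOrthogonalComplexStructure J)
    {N Ω : Set E} {f : E → E} (hf : PreservesFormOn J f N) (hΩ : IsOpen Ω) (hΩN : Ω ⊆ N)
    {g h : E → ℝ} (hh : ContDiff ℝ 1 h) (hgh : ∀ z ∈ Ω, g (f z) = h z) {z : E} (hz : z ∈ Ω) :
    ContDiffAt ℝ 1 g (f z) := by
  obtain ⟨M, -, hM⟩ := hf.exists_equiv hJ (hΩN hz)
  have hfz : ContDiffAt ℝ 1 f z :=
    (hf.contDiffOn.contDiffAt (hf.isOpen.mem_nhds (hΩN hz))).of_le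
      (WithTop.coe_le_coe.mpr (le_top : (1 : ℕ∞) ≤ ⊤))
  have hstrict := hfz.hasStrictFDerivAt' hM (by simp)
  have hinv : ContDiffAt ℝ 1 (hstrict.localInverse f M z) (f z) :=
    hfz.to_localInverse hM (by simp)
  refine (hh.contDiffAt.comp (f z) hinv).congr_of_eventuallyEq ?_
  have hΩ' : ∀ᶠ y in 𝓝 (f z), hstrict.localInverse f M z y ∈ Ω :=
    hstrict.localInverse_tendsto (hΩ.mem_nhds hz)
  filter_upwards [hstrict.eventually_right_inverse, hΩ'] with y h1 h2
  rw [Function.comp_apply, ← hgh _ h2, h1]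

variable [MeasurableSpace E] [BorelSpace E]

/-- Volume comparison: a cutoff function of a bounded set `D` which, on a spherical shell mapped
by a symplectic embedding `f`, is the push forward of a radial function, has the same integral as
that radial function. -/
lemma exists_cutoff_integral_eq {J : E →L[ℝ] E} (hJ : IsOrthogonalComplexStructure J)
    (hE : 3 ≤ Module.finrank ℝ E) {N : Set E} {f : E → E} (hf : PreservesFormOn J f N)
    (hinj : InjOn f N) {α β p q : ℝ} (hp : α < p) (hq : q < β)
    (hN : ∀ z : E, ‖z‖ ^ 2 ∈ Ioo α β → z ∈ N)
    {θ : ℝ → ℝ} (hθ : ContDiff ℝ 2 θ) {θ₀ : ℝ} (hθ' : ∀ t, t ∉ Icc p q → deriv θ t = 0)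
    (hθ₀ : ∀ t, q < t → θ t = θ₀)
    {D : Set E} (hD : IsBounded D) (hDf : frontier D ⊆ f '' {z | ‖z‖ ^ 2 ∈ Icc p q})
    (hθD : ∀ z : E, ‖z‖ ^ 2 ∈ Ioo α β → ‖z‖ ^ 2 ∉ Icc p q →
      θ (‖z‖ ^ 2) = D.indicator (fun _ => 1) (f z)) :
    ∃ ρ : E → ℝ, Integrable ρ ∧
      (∀ z : E, ‖z‖ ^ 2 ∈ Ioo α β → ρ (f z) = θ (‖z‖ ^ 2)) ∧
      (∀ y, y ∉ f '' {z | ‖z‖ ^ 2 ∈ Icc p q} → ρ y = D.indicator (fun _ => 1) y) ∧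
      Integrable (fun z : E => θ (‖z‖ ^ 2) - θ₀) ∧
      ∫ y, ρ y = ∫ z : E, (θ (‖z‖ ^ 2) - θ₀) := by
  classical
  set Ω : Set E := {z | ‖z‖ ^ 2 ∈ Ioo α β}
  set K : Set E := {z | ‖z‖ ^ 2 ∈ Icc p q}
  have hKΩ : K ⊆ Ω := fun z hz => ⟨hp.trans_le hz.1, hz.2.trans_lt hq⟩
  have hΩ : IsOpen Ω := isOpen_Ioo.preimage (f := fun z : E => ‖z‖ ^ 2) (by fun_prop)
  have hΩN : Ω ⊆ N := hN
  have hKball : K ⊆ closedBall (0 : E) √q := fun z hz => by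
    rw [mem_closedBall_zero_iff]
    exact Real.le_sqrt_of_sq_le hz.2
  have hK : IsCompact K := (isCompact_closedBall (0 : E) √q).of_isClosed_subset
    (isClosed_Icc.preimage (f := fun z : E => ‖z‖ ^ 2) (by fun_prop)) hKball
  have hfK : IsCompact (f '' K) :=
    hK.image_of_continuousOn (hf.contDiffOn.continuousOn.mono (hKΩ.trans hΩN))
  have hh : ContDiff ℝ 1 (fun z : E => θ (‖z‖ ^ 2)) :=
    (hθ.of_le (by norm_num)).comp (contDiff_norm_sq ℝ)
  have hhd (z v : E) : fderiv ℝ (fun z : E => θ (‖z‖ ^ 2)) z v =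
      2 * deriv θ (‖z‖ ^ 2) * ⟪z, v⟫_ℝ := by
    have h1 : HasFDerivAt (fun z : E => ‖z‖ ^ 2) (2 • innerSL ℝ z) z :=
      (hasStrictFDerivAt_norm_sq z).hasFDerivAt
    have h2 : HasDerivAt θ (deriv θ (‖z‖ ^ 2)) (‖z‖ ^ 2) :=
      (hθ.differentiable (by norm_num) _).hasDerivAt
    have h3 : HasFDerivAt (fun z : E => θ (‖z‖ ^ 2)) (deriv θ (‖z‖ ^ 2) • 2 • innerSL ℝ z) z :=
      h2.comp_hasFDerivAt z h1
    rw [h3.fderiv]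
    simp
    ring
  set ρ : E → ℝ := fun y => if y ∈ f '' Ω then θ (‖Function.invFunOn f Ω y‖ ^ 2)
    else D.indicator (fun _ => 1) y with hρ
  have hρf (z : E) (hz : z ∈ Ω) : ρ (f z) = θ (‖z‖ ^ 2) := by
    simp only [hρ, mem_image_of_mem f hz, if_true, (hinj.mono hΩN).leftInvOn_invFunOn hz]
  have hρD (y : E) (hy : y ∉ f '' K) : ρ y = D.indicator (fun _ => 1) y := by
    by_cases hyΩ : y ∈ f '' Ω
    · obtain ⟨z, hz, rfl⟩ := hyΩ
      rw [hρf z hz, hθD z hz fun h => hy ⟨z, h, rfl⟩]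
    · simp only [hρ, hyΩ, if_false]
  have hconst (y : E) (hy : y ∉ f '' Ω) : ∃ c : ℝ, ρ =ᶠ[𝓝 y] fun _ => c := by
    have hyK : y ∉ f '' K := fun h => hy (image_mono hKΩ h)
    have hρD' : ∀ᶠ x in 𝓝 y, ρ x = D.indicator (fun _ => 1) x := by
      filter_upwards [hfK.isClosed.isOpen_compl.mem_nhds hyK] with x hx using hρD x hx
    by_cases hyD : y ∈ closure D
    · have hyi : y ∈ interior D := by
        by_contra h
        exact hyK (hDf ⟨hyD, h⟩)
      refine ⟨1, ?_⟩
      filter_upwards [hρD', mem_interior_iff_mem_nhds.mp hyi] with x hx hxD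
      rw [hx, indicator_of_mem hxD]
    · refine ⟨0, ?_⟩
      filter_upwards [hρD', isClosed_closure.isOpen_compl.mem_nhds hyD] with x hx hxD
      rw [hx, indicator_of_notMem fun h => hxD (subset_closure h)]
  have hρC : ContDiff ℝ 1 ρ := by
    rw [contDiff_iff_contDiffAt]
    intro y
    by_cases hy : y ∈ f '' Ω
    · obtain ⟨z, hz, rfl⟩ := hy
      exact hf.contDiffAt_of_comp hJ hΩ hΩN hh hρf hz
    · obtain ⟨c, hc⟩ := hconst y hy
      exact contDiffAt_const.congr_of_eventuallyEq hc
  have hρsupp : HasCompactSupport ρ := by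
    refine HasCompactSupport.intro (hD.isCompact_closure.union hfK) fun y hy => ?_
    rw [hρD y fun h => hy (Or.inr h), indicator_of_notMem fun h => hy (Or.inl (subset_closure h))]
  have hg : ContDiff ℝ 1 (fun z : E => θ (‖z‖ ^ 2) - θ₀) := hh.sub contDiff_const
  have hgsupp : HasCompactSupport (fun z : E => θ (‖z‖ ^ 2) - θ₀) := by
    refine HasCompactSupport.intro (isCompact_closedBall (0 : E) √q) fun z hz => ?_
    rw [hθ₀, sub_self]
    rw [mem_closedBall_zero_iff] at hz
    by_contra! h
    exact hz (Real.le_sqrt_of_sq_le h)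
  have hρd (z : E) (hz : z ∈ Ω) : fderiv ℝ ρ (f z) (f z) =
      2 * deriv θ (‖z‖ ^ 2) * ⟪J (f z), fderiv ℝ f z (J z)⟫_ℝ := by
    obtain ⟨M, hM, hMd⟩ := hf.exists_equiv hJ (hΩN hz)
    obtain ⟨v, hv⟩ := M.surjective (f z)
    have hv' : fderiv ℝ f z v = f z := by rw [← hM]; exact hv
    have h1 : HasFDerivAt (ρ ∘ f) ((fderiv ℝ ρ (f z)).comp (M : E →L[ℝ] E)) z :=
      (hρC.differentiable (by norm_num) (f z)).hasFDerivAt.comp z hMd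
    have h2 : ρ ∘ f =ᶠ[𝓝 z] fun z => θ (‖z‖ ^ 2) := by
      filter_upwards [hΩ.mem_nhds hz] with x hx using hρf x hx
    have h3 : fderiv ℝ ρ (f z) (f z) = fderiv ℝ (ρ ∘ f) z v := by
      rw [h1.fderiv, ContinuousLinearMap.comp_apply, hM, hv']
    rw [h3, h2.fderiv_eq, hhd]
    congr 1
    rw [← hv', hf.inner_fderiv z (hΩN hz), hJ.inner_map_map, real_inner_comm]
  have hmain : ∫ y, fderiv ℝ ρ y y = ∫ z : E, fderiv ℝ (fun z : E => θ (‖z‖ ^ 2) - θ₀) z z := by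
    calc ∫ y, fderiv ℝ ρ y y = ∫ y in f '' Ω, fderiv ℝ ρ y y := by
          refine (setIntegral_eq_integral_of_forall_compl_eq_zero fun y hy => ?_).symm
          obtain ⟨c, hc⟩ := hconst y hy
          rw [hc.fderiv_eq]
          simp
      _ = ∫ z in Ω, |(fderiv ℝ f z).det| • fderiv ℝ ρ (f z) (f z) :=
          integral_image_eq_integral_abs_det_fderiv_smul volume hΩ.measurableSet
            (fun z hz => ((hf.contDiffOn.contDiffAt
              (hf.isOpen.mem_nhds (hΩN hz))).differentiableAt
                (by simp)).hasFDerivAt.hasFDerivWithinAt) (hinj.mono hΩN) _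
      _ = ∫ z in Ω, 2 * deriv θ (‖z‖ ^ 2) * ⟪J (f z), fderiv ℝ f z (J z)⟫_ℝ := by
          refine setIntegral_congr_fun hΩ.measurableSet fun z hz => ?_
          simp only [abs_det_eq_one_of_preserves_form hJ _ (hf.inner_fderiv z (hΩN hz)),
            one_smul, hρd z hz]
      _ = ∫ z, 2 * deriv θ (‖z‖ ^ 2) * ⟪J (f z), fderiv ℝ f z (J z)⟫_ℝ := by
          refine setIntegral_eq_integral_of_forall_compl_eq_zero fun z hz => ?_
          rw [hθ' _ fun h => hz (hKΩ h), mul_zero, zero_mul]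
      _ = ∫ z : E, 2 * deriv θ (‖z‖ ^ 2) * ‖z‖ ^ 2 :=
          integral_radial_mul_action hJ hE hf (c := fun t => 2 * deriv θ t)
            (continuous_const.mul (hθ.continuous_deriv (by norm_num)))
            (fun t ht => by rw [hθ' t ht, mul_zero]) fun z hz => hΩN (hKΩ hz)
      _ = ∫ z : E, fderiv ℝ (fun z : E => θ (‖z‖ ^ 2) - θ₀) z z := by
          refine integral_congr_ae (Eventually.of_forall fun z => ?_)
          simp only [fderiv_sub_const, hhd, real_inner_self_eq_norm_sq]
  refine ⟨ρ, hρC.continuous.integrable_of_hasCompactSupport hρsupp, hρf, hρD,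
    hg.continuous.integrable_of_hasCompactSupport hgsupp, ?_⟩
  rw [integral_fderiv_apply_self ρ hρC hρsupp, integral_fderiv_apply_self _ hg hgsupp] at hmain
  refine mul_left_cancel₀ (neg_ne_zero.mpr ?_) hmain
  have : Module.finrank ℝ E ≠ 0 := by omega
  exact_mod_cast this

end VolumeComparison

section StandardStructure

/-- The other index of the symplectic coordinate pair containing `k`. -/
def conjIndex (n : ℕ) (k : Fin (2 * n)) : Fin (2 * n) :=
  ⟨if k.1 % 2 = 0 then k.1 + 1 else k.1 - 1, by have := k.isLt; split_ifs <;> omega⟩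

/-- The standard complex structure on `ℝ^{2n}`. -/
def stdJ (n : ℕ) : R2n n →L[ℝ] R2n n :=
  LinearMap.toContinuousLinearMap
    { toFun := fun v => WithLp.toLp 2 fun k =>
        if k.1 % 2 = 0 then -v (conjIndex n k) else v (conjIndex n k)
      map_add' := fun v w => by
        ext k
        simp only [PiLp.add_apply]
        split_ifs <;> ring
      map_smul' := fun c v => by
        ext k
        simp only [PiLp.smul_apply, smul_eq_mul, RingHom.id_apply]
        split_ifs <;> ring }

lemma stdJ_apply (n : ℕ) (v : R2n n) (k : Fin (2 * n)) :
    stdJ n v k = if k.1 % 2 = 0 then -v (conjIndex n k) else v (conjIndex n k) := rfl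

lemma sum_fin_two_mul (n : ℕ) (g : Fin (2 * n) → ℝ) :
    ∑ k, g k = ∑ i : Fin n, (g ⟨2 * i.1, by have := i.isLt; omega⟩ +
      g ⟨2 * i.1 + 1, by have := i.isLt; omega⟩) := by
  rw [← (finCongr (mul_comm n 2)).sum_comp, ← finProdFinEquiv.sum_comp, Fintype.sum_prod_type]
  refine Finset.sum_congr rfl fun i _ => ?_
  rw [Fin.sum_univ_two]
  congr 2 <;> ext <;> simp [finProdFinEquiv] <;> ring

lemma inner_stdJ_left (n : ℕ) (v w : R2n n) : ⟪stdJ n v, w⟫_ℝ = sympForm n v w := by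
  rw [PiLp.inner_apply, sum_fin_two_mul, sympForm]
  refine Finset.sum_congr rfl fun i _ => ?_
  simp only [stdJ_apply, conjIndex, RCLike.inner_apply, conj_trivial, Nat.mul_mod_right, if_true]
  have h : (2 * i.1 + 1) % 2 ≠ 0 := by omega
  simp only [h, if_false, add_tsub_cancel_right]
  ring

lemma isOrthogonalComplexStructure_stdJ (n : ℕ) : IsOrthogonalComplexStructure (stdJ n) where
  apply_apply v := by
    ext k
    have hconj : conjIndex n (conjIndex n k) = k := by
      ext
      simp only [conjIndex]
      split_ifs <;> omega
    have hpar : (conjIndex n k).1 % 2 = 0 ↔ ¬ k.1 % 2 = 0 := by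
      simp only [conjIndex]
      split_ifs <;> omega
    simp only [stdJ_apply, hconj, hpar, PiLp.neg_apply]
    split_ifs <;> simp
  inner_left v w := by
    rw [real_inner_comm (stdJ n w) v, inner_stdJ_left, inner_stdJ_left, sympForm, sympForm,
      ← Finset.sum_neg_distrib]
    exact Finset.sum_congr rfl fun i _ => by ring

end StandardStructure

section Sides

variable {E : Type*} [NormedAddCommGroup E] [NormedSpace ℝ E]

lemma isPreconnected_sq_norm_mem_Ioo (hE : 1 < Module.rank ℝ E) {s t : ℝ} (hs : 0 ≤ s) :
    IsPreconnected {z : E | ‖z‖ ^ 2 ∈ Ioo s t} := by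
  have h := (((isPreconnected_Ioo (a := s) (b := t)).image Real.sqrt
    Real.continuous_sqrt.continuousOn).prod (isPreconnected_sphere hE (0 : E) 1)).image
      (fun x : ℝ × E => x.1 • x.2) (by fun_prop)
  convert h using 1
  ext z
  simp only [mem_ofPred_eq, mem_image, Prod.exists, mem_prod, mem_sphere_zero_iff_norm]
  constructor
  · intro hz
    have hz0 : ‖z‖ ≠ 0 := fun h0 => by simp [h0] at hz; linarith [hz.1]
    refine ⟨‖z‖, ‖z‖⁻¹ • z, ⟨⟨‖z‖ ^ 2, hz, Real.sqrt_sq (norm_nonneg z)⟩, ?_⟩, ?_⟩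
    · rw [norm_smul, norm_inv, norm_norm, inv_mul_cancel₀ hz0]
    · rw [smul_smul, mul_inv_cancel₀ hz0, one_smul]
  · rintro ⟨_, u, ⟨⟨τ, hτ, rfl⟩, hu⟩, rfl⟩
    rw [norm_smul, hu, mul_one, norm_eq_abs, sq_abs, Real.sq_sqrt (hs.trans hτ.1.le)]
    exact hτ

lemma isOpen_sq_norm_mem_Ioo {F : Type*} [SeminormedAddCommGroup F] (s t : ℝ) :
    IsOpen {z : F | ‖z‖ ^ 2 ∈ Ioo s t} :=
  isOpen_Ioo.preimage (f := fun z : F => ‖z‖ ^ 2) (by fun_prop)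

lemma frontier_connectedComponentIn_compl_subset {X : Type*} [TopologicalSpace X]
    [LocallyConnectedSpace X] {F : Set X} (hF : IsClosed F) (x : X) :
    frontier (connectedComponentIn Fᶜ x) ⊆ F := by
  intro y hy
  by_contra hyF
  have hopen : IsOpen (connectedComponentIn Fᶜ x) := hF.isOpen_compl.connectedComponentIn
  obtain ⟨w, hwy, hwx⟩ := mem_closure_iff.mp hy.1 _
    (hF.isOpen_compl.connectedComponentIn (x := y)) (mem_connectedComponentIn hyF)
  refine hy.2 ?_
  rw [hopen.interior_eq, connectedComponentIn_eq hwx, ← connectedComponentIn_eq hwy]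
  exact mem_connectedComponentIn hyF

lemma subset_connectedComponentIn_or_disjoint {X : Type*} [TopologicalSpace X] {F s : Set X}
    (hs : IsPreconnected s) (hsF : s ⊆ F) (x : X) :
    s ⊆ connectedComponentIn F x ∨ Disjoint s (connectedComponentIn F x) := by
  by_cases h : Disjoint s (connectedComponentIn F x)
  · exact Or.inr h
  · obtain ⟨y, hys, hyx⟩ := not_disjoint_iff.mp h
    rw [connectedComponentIn_eq hyx]
    exact Or.inl (hs.subset_connectedComponentIn hys hsF)

/-- A bounded component of the complement of an embedded sphere with an embedded collar contains
exactly one side of the collar. -/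
lemma collar_side_of_bounded_component [FiniteDimensional ℝ E] (hE : 1 < Module.rank ℝ E)
    {f : E → E} {r α β : ℝ} (hα : 0 ≤ α)
    (hαr : α < r ^ 2) (hrβ : r ^ 2 < β) (hr : 0 < r)
    (hcont : ContinuousOn f {z | ‖z‖ ^ 2 ∈ Ioo α β}) (hinj : InjOn f {z | ‖z‖ ^ 2 ∈ Ioo α β})
    (hopen : IsOpen (f '' {z | ‖z‖ ^ 2 ∈ Ioo α β}))
    {x : E} (hx : x ∈ (f '' sphere 0 r)ᶜ)
    (hbd : IsBounded (connectedComponentIn (f '' sphere 0 r)ᶜ x)) :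
    (f '' {z | ‖z‖ ^ 2 ∈ Ioo α (r ^ 2)} ⊆ connectedComponentIn (f '' sphere 0 r)ᶜ x ∧
      Disjoint (f '' {z | ‖z‖ ^ 2 ∈ Ioo (r ^ 2) β})
        (connectedComponentIn (f '' sphere 0 r)ᶜ x)) ∨
    (f '' {z | ‖z‖ ^ 2 ∈ Ioo (r ^ 2) β} ⊆ connectedComponentIn (f '' sphere 0 r)ᶜ x ∧
      Disjoint (f '' {z | ‖z‖ ^ 2 ∈ Ioo α (r ^ 2)})
        (connectedComponentIn (f '' sphere 0 r)ᶜ x)) := by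
  have : Nontrivial E := rank_pos_iff_nontrivial.mp (zero_lt_one.trans hE)
  have : ProperSpace E := FiniteDimensional.proper_real E
  set Ω : Set E := {z | ‖z‖ ^ 2 ∈ Ioo α β}
  set F : Set E := f '' sphere 0 r
  set D : Set E := connectedComponentIn Fᶜ x
  have hSΩ : sphere (0 : E) r ⊆ Ω := fun z hz => by
    rw [mem_sphere_zero_iff_norm] at hz
    exact ⟨by rwa [hz], by rwa [hz]⟩
  have hFc : IsCompact F := (isCompact_sphere 0 r).image_of_continuousOn (hcont.mono hSΩ)
  have hDo : IsOpen D := hFc.isClosed.isOpen_compl.connectedComponentIn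
  have hfr : frontier D ⊆ F := frontier_connectedComponentIn_compl_subset hFc.isClosed x
  have hne : D.Nonempty := ⟨x, mem_connectedComponentIn hx⟩
  have hclopen (s : Set E) (hs : IsClopen s) (hsne : s.Nonempty) (hsb : IsBounded s) : False := by
    rw [hs.eq_univ hsne] at hsb
    exact NormedSpace.unbounded_univ ℝ E hsb
  have hsub {s t : ℝ} (hst : ∀ u ∈ Ioo s t, u ∈ Ioo α β ∧ u ≠ r ^ 2) (hs : 0 ≤ s) :
      f '' {z | ‖z‖ ^ 2 ∈ Ioo s t} ⊆ D ∨ Disjoint (f '' {z | ‖z‖ ^ 2 ∈ Ioo s t}) D := by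
    refine subset_connectedComponentIn_or_disjoint
      ((isPreconnected_sq_norm_mem_Ioo hE hs).image f
        (hcont.mono fun z hz => (hst _ hz).1)) ?_ x
    rintro _ ⟨z, hz, rfl⟩ ⟨w, hw, hwz⟩
    rw [hinj (hSΩ hw) (hst _ hz).1 hwz] at hw
    rw [mem_sphere_zero_iff_norm] at hw
    exact (hst _ hz).2 (by rw [hw])
  have hcover (z : E) (hz : z ∈ Ω) : ‖z‖ ^ 2 ∈ Ioo α (r ^ 2) ∨ z ∈ sphere (0 : E) r ∨
      ‖z‖ ^ 2 ∈ Ioo (r ^ 2) β := by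
    rcases lt_trichotomy (‖z‖ ^ 2) (r ^ 2) with h | h | h
    · exact Or.inl ⟨hz.1, h⟩
    · refine Or.inr (Or.inl ?_)
      rw [mem_sphere_zero_iff_norm]
      exact (sq_eq_sq₀ (norm_nonneg z) hr.le).mp h
    · exact Or.inr (Or.inr ⟨h, hz.2⟩)
  have hin := hsub (s := α) (t := r ^ 2)
    (fun u hu => ⟨⟨hu.1, hu.2.trans hrβ⟩, hu.2.ne⟩) hα
  have hout := hsub (s := r ^ 2) (t := β)
    (fun u hu => ⟨⟨hαr.trans hu.1, hu.2⟩, hu.1.ne'⟩) (sq_nonneg r)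
  rcases hin with hin | hin <;> rcases hout with hout | hout
  · exfalso
    have hunion : D ∪ F = D ∪ f '' Ω := by
      refine Subset.antisymm (union_subset_union_right _ (image_mono hSΩ))
        (union_subset subset_union_left ?_)
      rintro _ ⟨z, hz, rfl⟩
      rcases hcover z hz with h | h | h
      · exact Or.inl (hin ⟨z, h, rfl⟩)
      · exact Or.inr ⟨z, h, rfl⟩
      · exact Or.inl (hout ⟨z, h, rfl⟩)
    refine hclopen (D ∪ F) ⟨?_, ?_⟩ hne.inl (hbd.union hFc.isBounded)
    · refine isClosed_of_closure_subset ?_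
      rw [closure_union, hFc.isClosed.closure_eq]
      refine union_subset (fun y hy => ?_) subset_union_right
      by_cases hyD : y ∈ D
      · exact Or.inl hyD
      · exact Or.inr (hfr ⟨hy, by rwa [hDo.interior_eq]⟩)
    · rw [hunion]
      exact hDo.union hopen
  · exact Or.inl ⟨hin, hout⟩
  · exact Or.inr ⟨hout, hin⟩
  · exfalso
    refine hclopen D ⟨?_, hDo⟩ hne hbd
    refine isClosed_of_closure_subset fun y hy => ?_
    by_contra hyD
    obtain ⟨z, hz, rfl⟩ := hfr ⟨hy, by rwa [hDo.interior_eq]⟩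
    obtain ⟨_, ⟨w, hw, rfl⟩, hwD⟩ := mem_closure_iff.mp hy _ hopen ⟨z, hSΩ hz, rfl⟩
    rcases hcover w hw with h | h | h
    · exact disjoint_left.mp hin ⟨w, h, rfl⟩ hwD
    · exact connectedComponentIn_subset _ _ hwD ⟨w, h, rfl⟩
    · exact disjoint_left.mp hout ⟨w, h, rfl⟩ hwD

end Sides

section Sides

variable {E : Type*} [NormedAddCommGroup E] [InnerProductSpace ℝ E] [FiniteDimensional ℝ E]
  [MeasurableSpace E] [BorelSpace E]

/-- If the image of the inner side of a symplectic spherical shell lies in `D`, and that of the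
outer side does not meet `D`, then `D` has at least the volume of the ball. -/
lemma volume_ball_le_of_inner_side {J : E →L[ℝ] E} (hJ : IsOrthogonalComplexStructure J)
    (hE : 3 ≤ Module.finrank ℝ E) {N : Set E} {f : E → E} (hf : PreservesFormOn J f N)
    (hinj : InjOn f N) {r α β : ℝ} (hr : 0 < r) (hαr : α < r ^ 2) (hrβ : r ^ 2 < β)
    (hN : ∀ z : E, ‖z‖ ^ 2 ∈ Ioo α β → z ∈ N)
    {D : Set E} (hD : IsBounded D) (hDo : IsOpen D) (hDf : frontier D ⊆ f '' sphere 0 r)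
    (hin : f '' {z | ‖z‖ ^ 2 ∈ Ioo α (r ^ 2)} ⊆ D)
    (hout : Disjoint (f '' {z | ‖z‖ ^ 2 ∈ Ioo (r ^ 2) β}) D) :
    r ^ Module.finrank ℝ E * volume.real (ball (0 : E) 1) ≤ volume.real D := by
  have : Nontrivial E := Module.nontrivial_of_finrank_pos (R := ℝ) (by omega)
  have hs (s : ℝ) (hs : s ∈ Ioo α (r ^ 2)) :
      √s ^ Module.finrank ℝ E * volume.real (ball (0 : E) 1) ≤ volume.real D := by
    obtain ⟨s', hss', hs'⟩ := exists_between hs.2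
    have hd : 0 < s' - s := sub_pos.mpr hss'
    set θ : ℝ → ℝ := fun t => smoothTransition ((s' - t) / (s' - s))
    have hθ1 (t : ℝ) (ht : t ≤ s) : θ t = 1 :=
      smoothTransition.one_of_one_le (by rw [le_div_iff₀ hd]; linarith)
    have hθ0 (t : ℝ) (ht : s' ≤ t) : θ t = 0 :=
      smoothTransition.zero_of_nonpos (div_nonpos_of_nonpos_of_nonneg (by linarith) hd.le)
    have hθsmooth : ContDiff ℝ 2 θ :=
      smoothTransition.contDiff.comp ((contDiff_const.sub contDiff_id).div_const _)
    have hθd (t : ℝ) (ht : t ∉ Icc s (r ^ 2)) : deriv θ t = 0 := by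
      rcases lt_or_ge t s with h | h
      · have : θ =ᶠ[𝓝 t] fun _ => 1 := by
          filter_upwards [Iio_mem_nhds h] with τ hτ using hθ1 τ (le_of_lt hτ)
        rw [this.deriv_eq, deriv_const]
      · have h' : s' < t := by
          by_contra! h'
          exact ht ⟨h, h'.trans hs'.le⟩
        have : θ =ᶠ[𝓝 t] fun _ => 0 := by
          filter_upwards [Ioi_mem_nhds h'] with τ hτ using hθ0 τ (le_of_lt hτ)
        rw [this.deriv_eq, deriv_const]
    obtain ⟨ρ, hρint, hρf, hρD, hgint, heq⟩ := exists_cutoff_integral_eq hJ hE hf hinj hs.1 hrβ hN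
      hθsmooth (θ₀ := 0) hθd (fun t ht => hθ0 t (hs'.trans ht).le) hD
      (hDf.trans (image_mono fun z hz => by
        rw [mem_sphere_zero_iff_norm] at hz
        simp [hz, hs.2.le]))
      (fun z hz hzK => by
        rcases lt_or_ge (‖z‖ ^ 2) s with h | h
        · rw [hθ1 _ h.le, indicator_of_mem (hin ⟨z, ⟨hz.1, h.trans hs.2⟩, rfl⟩)]
        · have h' : r ^ 2 < ‖z‖ ^ 2 := by
            by_contra! h'
            exact hzK ⟨h, h'⟩
          rw [hθ0 _ (hs'.trans h').le,
            indicator_of_notMem (disjoint_left.mp hout ⟨z, ⟨h', hz.2⟩, rfl⟩)])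
    have hρle (y : E) : ρ y ≤ D.indicator (fun _ => 1) y := by
      by_cases hy : y ∈ f '' {z | ‖z‖ ^ 2 ∈ Icc s (r ^ 2)}
      · obtain ⟨z, hz, rfl⟩ := hy
        rw [hρf z ⟨hs.1.trans_le hz.1, hz.2.trans_lt hrβ⟩]
        rcases hz.2.lt_or_eq with h | h
        · rw [indicator_of_mem (hin ⟨z, ⟨hs.1.trans_le hz.1, h⟩, rfl⟩)]
          exact smoothTransition.le_one _
        · rw [h, hθ0 _ hs'.le]
          exact indicator_nonneg (fun _ _ => zero_le_one) _
      · exact (hρD y hy).le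
    have hgge (z : E) : (ball (0 : E) √s).indicator (fun _ => (1 : ℝ)) z ≤ θ (‖z‖ ^ 2) - 0 := by
      rw [sub_zero]
      by_cases hz : z ∈ ball (0 : E) √s
      · rw [indicator_of_mem hz, hθ1]
        rw [mem_ball_zero_iff] at hz
        exact ((Real.lt_sqrt (norm_nonneg z)).mp hz).le
      · rw [indicator_of_notMem hz]
        exact smoothTransition.nonneg _
    have hDfin : volume D ≠ ⊤ := hD.measure_lt_top.ne
    calc √s ^ Module.finrank ℝ E * volume.real (ball (0 : E) 1)
        = volume.real (ball (0 : E) √s) := by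
          simp only [measureReal_def]
          rw [Measure.addHaar_ball volume 0 (Real.sqrt_nonneg s), ENNReal.toReal_mul,
            ENNReal.toReal_ofReal (by positivity)]
      _ = ∫ z, (ball (0 : E) √s).indicator (fun _ => (1 : ℝ)) z := by
          rw [integral_indicator_const _ measurableSet_ball, smul_eq_mul, mul_one]
      _ ≤ ∫ z : E, (θ (‖z‖ ^ 2) - 0) :=
          integral_mono ((integrable_indicator_iff measurableSet_ball).mpr
            (integrableOn_const measure_ball_lt_top.ne)) hgint hgge
      _ = ∫ y, ρ y := heq.symm
      _ ≤ ∫ y, D.indicator (fun _ => (1 : ℝ)) y :=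
          integral_mono hρint ((integrable_indicator_iff hDo.measurableSet).mpr
            (integrableOn_const hDfin)) hρle
      _ = volume.real D := by
          rw [integral_indicator_const _ hDo.measurableSet, smul_eq_mul, mul_one]
  have hlim : Tendsto (fun s => √s ^ Module.finrank ℝ E * volume.real (ball (0 : E) 1))
      (𝓝[<] (r ^ 2)) (𝓝 (√(r ^ 2) ^ Module.finrank ℝ E * volume.real (ball (0 : E) 1))) := by
    refine Tendsto.mono_left (Continuous.tendsto ?_ _) nhdsWithin_le_nhds
    fun_prop
  rw [Real.sqrt_sq hr.le] at hlim
  refine le_of_tendsto hlim ?_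
  filter_upwards [Ioo_mem_nhdsLT hαr] with s h using hs s h

/-- A bounded set cannot contain the image of the outer side of a symplectic spherical shell
without meeting that of the inner side. -/
lemma false_of_outer_side {J : E →L[ℝ] E} (hJ : IsOrthogonalComplexStructure J)
    (hE : 3 ≤ Module.finrank ℝ E) {N : Set E} {f : E → E} (hf : PreservesFormOn J f N)
    (hinj : InjOn f N) {r α β : ℝ} (hr : 0 < r) (hαr : α < r ^ 2) (hrβ : r ^ 2 < β)
    (hN : ∀ z : E, ‖z‖ ^ 2 ∈ Ioo α β → z ∈ N)
    {D : Set E} (hD : IsBounded D) (hDf : frontier D ⊆ f '' sphere 0 r)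
    (hout : f '' {z | ‖z‖ ^ 2 ∈ Ioo (r ^ 2) β} ⊆ D)
    (hin : Disjoint (f '' {z | ‖z‖ ^ 2 ∈ Ioo α (r ^ 2)}) D) : False := by
  obtain ⟨q, hrq, hqβ⟩ := exists_between hrβ
  have hd : 0 < q - r ^ 2 := sub_pos.mpr hrq
  set θ : ℝ → ℝ := fun t => smoothTransition ((t - r ^ 2) / (q - r ^ 2))
  have hθ1 (t : ℝ) (ht : q ≤ t) : θ t = 1 :=
    smoothTransition.one_of_one_le (by rw [le_div_iff₀ hd]; linarith)
  have hθ0 (t : ℝ) (ht : t ≤ r ^ 2) : θ t = 0 :=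
    smoothTransition.zero_of_nonpos (div_nonpos_of_nonpos_of_nonneg (by linarith) hd.le)
  have hθsmooth : ContDiff ℝ 2 θ :=
    smoothTransition.contDiff.comp ((contDiff_id.sub contDiff_const).div_const _)
  have hθd (t : ℝ) (ht : t ∉ Icc (r ^ 2) q) : deriv θ t = 0 := by
    rcases lt_or_ge t (r ^ 2) with h | h
    · have : θ =ᶠ[𝓝 t] fun _ => 0 := by
        filter_upwards [Iio_mem_nhds h] with τ hτ using hθ0 τ (le_of_lt hτ)
      rw [this.deriv_eq, deriv_const]
    · have h' : q < t := by
        by_contra! h'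
        exact ht ⟨h, h'⟩
      have : θ =ᶠ[𝓝 t] fun _ => 1 := by
        filter_upwards [Ioi_mem_nhds h'] with τ hτ using hθ1 τ (le_of_lt hτ)
      rw [this.deriv_eq, deriv_const]
  obtain ⟨ρ, hρint, hρf, hρD, hgint, heq⟩ := exists_cutoff_integral_eq hJ hE hf hinj hαr hqβ hN
    hθsmooth (θ₀ := 1) hθd (fun t ht => hθ1 t ht.le) hD
    (hDf.trans (image_mono fun z hz => by
      rw [mem_sphere_zero_iff_norm] at hz
      simp [hz, hrq.le]))
    (fun z hz hzK => by
      rcases lt_or_ge (‖z‖ ^ 2) (r ^ 2) with h | h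
      · rw [hθ0 _ h.le, indicator_of_notMem (disjoint_left.mp hin ⟨z, ⟨hz.1, h⟩, rfl⟩)]
      · have h' : q < ‖z‖ ^ 2 := by
          by_contra! h'
          exact hzK ⟨h, h'⟩
        rw [hθ1 _ h'.le, indicator_of_mem (hout ⟨z, ⟨hrq.trans h', hz.2⟩, rfl⟩)])
  have hρ0 (y : E) : 0 ≤ ρ y := by
    by_cases hy : y ∈ f '' {z | ‖z‖ ^ 2 ∈ Icc (r ^ 2) q}
    · obtain ⟨z, hz, rfl⟩ := hy
      rw [hρf z ⟨hαr.trans_le hz.1, hz.2.trans_lt hqβ⟩]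
      exact smoothTransition.nonneg _
    · rw [hρD y hy]
      exact indicator_nonneg (fun _ _ => zero_le_one) _
  have hgle (z : E) : θ (‖z‖ ^ 2) - 1 ≤ (ball (0 : E) r).indicator (fun _ => (-1 : ℝ)) z := by
    by_cases hz : z ∈ ball (0 : E) r
    · rw [indicator_of_mem hz, hθ0, zero_sub]
      rw [mem_ball_zero_iff] at hz
      exact pow_le_pow_left₀ (norm_nonneg z) hz.le 2
    · rw [indicator_of_notMem hz, sub_nonpos]
      exact smoothTransition.le_one _
  have h1 : 0 ≤ ∫ y, ρ y := integral_nonneg hρ0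
  have h2 : ∫ z : E, (θ (‖z‖ ^ 2) - 1) ≤
      ∫ z, (ball (0 : E) r).indicator (fun _ => (-1 : ℝ)) z :=
    integral_mono hgint ((integrable_indicator_iff measurableSet_ball).mpr
      (integrableOn_const measure_ball_lt_top.ne)) hgle
  rw [integral_indicator_const _ measurableSet_ball, smul_eq_mul] at h2
  have h3 : 0 < volume.real (ball (0 : E) r) :=
    ENNReal.toReal_pos (measure_ball_pos _ _ hr).ne' measure_ball_lt_top.ne
  linarith

end Sides

section Shell

/-- A neighbourhood of a closed spherical shell contains an open shell reaching beyond the outer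
sphere. -/
lemma exists_open_shell_subset {E : Type*} [NormedAddCommGroup E] [NormedSpace ℝ E]
    [ProperSpace E] {N : Set E} (hN : IsOpen N) {r a : ℝ} (hr : 0 < r)
    (hsub : closedBall (0 : E) r \ ball 0 a ⊆ N) (ha : a < r) :
    ∃ β, r ^ 2 < β ∧ ∀ z : E, ‖z‖ ^ 2 ∈ Ioo (a ^ 2) β → z ∈ N := by
  have hS : sphere (0 : E) r ⊆ N := fun z hz => hsub ⟨sphere_subset_closedBall hz, by
    rw [mem_sphere_zero_iff_norm] at hz
    rw [mem_ball_zero_iff, hz]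
    exact ha.le.not_gt⟩
  obtain ⟨η, hη, hthick⟩ := (isCompact_sphere (0 : E) r).exists_thickening_subset_open hN hS
  refine ⟨(r + η) ^ 2, pow_lt_pow_left₀ (by linarith) hr.le two_ne_zero, fun z hz => ?_⟩
  have hza : a < ‖z‖ := lt_of_pow_lt_pow_left₀ 2 (norm_nonneg z) hz.1
  have hzη : ‖z‖ < r + η := lt_of_pow_lt_pow_left₀ 2 (by positivity) hz.2
  rcases le_or_gt ‖z‖ r with h | h
  · refine hsub ⟨mem_closedBall_zero_iff.mpr h, ?_⟩
    rw [mem_ball_zero_iff]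
    exact hza.le.not_gt
  · have hz0 : 0 < ‖z‖ := hr.trans h
    refine hthick (mem_thickening_iff.mpr ⟨(r / ‖z‖) • z, ?_, ?_⟩)
    · rw [mem_sphere_zero_iff_norm, norm_smul, norm_div, norm_norm, norm_of_nonneg hr.le,
        div_mul_cancel₀ _ hz0.ne']
    · have : z - (r / ‖z‖) • z = (1 - r / ‖z‖) • z := by module
      rw [dist_eq_norm, this, norm_smul, norm_eq_abs, abs_of_nonneg, sub_mul, one_mul,
        div_mul_cancel₀ _ hz0.ne']
      · linarith
      · rw [sub_nonneg, div_le_one hz0]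
        exact h.le

end Shell

/-- If `φ` is a symplectic embedding of a neighbourhood of `r A_δ` into the shell
`U_ε = B_1 \ closure(B_(1-ε))` and the bounded connected component `D` of the complement
of `φ(S_r^(2n-1))` is contained in `U_ε`, then `r² < (1 - (1-ε)^(2n))^(1/n)`. -/
theorem radius_bound_of_component_in_spherical_shell
    (n : ℕ) (hn : 2 ≤ n) (δ ε : ℝ) (hδ : δ ∈ Ioo (0 : ℝ) 1) (hε : ε ∈ Ioo (0 : ℝ) 1)
    (r : ℝ) (hr : 0 < r)
    (N : Set (R2n n)) (φ : R2n n → R2n n)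
    (hN : closedBall (0 : R2n n) r \ ball 0 (r * (1 - δ)) ⊆ N)
    (hφ : IsSympEmbOn n N (ball (0 : R2n n) 1 \ closedBall 0 (1 - ε)) φ)
    (D : Set (R2n n)) (x : R2n n)
    (hx : x ∈ (φ '' sphere (0 : R2n n) r)ᶜ)
    (hD : D = connectedComponentIn (φ '' sphere (0 : R2n n) r)ᶜ x)
    (hbd : IsBounded D)
    (hsub : D ⊆ ball (0 : R2n n) 1 \ closedBall 0 (1 - ε)) :
    r ^ 2 < (1 - (1 - ε) ^ (2 * n)) ^ ((1 : ℝ) / (n : ℝ)) := by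
  have hpre : PreservesFormOn (stdJ n) φ N :=
    ⟨hφ.1, hφ.2.1, fun p hp v w => by
      rw [inner_stdJ_left, inner_stdJ_left]
      exact hφ.2.2.2.2 p hp v w⟩
  have hinj : InjOn φ N := hφ.2.2.1
  have hJ := isOrthogonalComplexStructure_stdJ n
  have hdim : Module.finrank ℝ (R2n n) = 2 * n := by simp
  have hE : 3 ≤ Module.finrank ℝ (R2n n) := by omega
  have hrank : 1 < Module.rank ℝ (R2n n) := by
    rw [← Module.finrank_eq_rank]
    exact_mod_cast (show 1 < Module.finrank ℝ (R2n n) by omega)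
  have : Nontrivial (R2n n) := Module.nontrivial_of_finrank_pos (R := ℝ) (by omega)
  have ha0 : 0 ≤ r * (1 - δ) := mul_nonneg hr.le (by linarith [hδ.2])
  have har : r * (1 - δ) < r := by nlinarith [hδ.1]
  obtain ⟨β, hrβ, hβ⟩ := exists_open_shell_subset hφ.1 hr hN har
  have hαr : (r * (1 - δ)) ^ 2 < r ^ 2 := pow_lt_pow_left₀ har ha0 two_ne_zero
  have hΩN : {z : R2n n | ‖z‖ ^ 2 ∈ Ioo ((r * (1 - δ)) ^ 2) β} ⊆ N := hβ
  have hFc : IsCompact (φ '' sphere (0 : R2n n) r) := by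
    refine (isCompact_sphere 0 r).image_of_continuousOn (hφ.2.1.continuousOn.mono fun z hz => ?_)
    rw [mem_sphere_zero_iff_norm] at hz
    exact hβ z ⟨by rwa [hz], by rwa [hz]⟩
  subst hD
  set D := connectedComponentIn (φ '' sphere (0 : R2n n) r)ᶜ x
  have hDo : IsOpen D := hFc.isClosed.isOpen_compl.connectedComponentIn
  have hDf : frontier D ⊆ φ '' sphere (0 : R2n n) r :=
    frontier_connectedComponentIn_compl_subset hFc.isClosed x
  rcases collar_side_of_bounded_component hrank (sq_nonneg (r * (1 - δ))) hαr hrβ hr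
    (hφ.2.1.continuousOn.mono hΩN) (hinj.mono hΩN)
    (hpre.isOpen_image hJ (isOpen_sq_norm_mem_Ioo _ _) hΩN) hx hbd with ⟨hin, hout⟩ | ⟨hout, hin⟩
  · have hvol := volume_ball_le_of_inner_side hJ hE hpre hinj hr hαr hrβ hβ hbd hDo
      hDf hin hout
    rw [hdim] at hvol
    set V := volume.real (ball (0 : R2n n) 1)
    have hVpos : 0 < V :=
      ENNReal.toReal_pos (measure_ball_pos _ _ one_pos).ne' measure_ball_lt_top.ne
    set A : Set (R2n n) := {z | ‖z‖ ^ 2 ∈ Ioo (r ^ 2) β}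
    have hAN : A ⊆ N := fun z hz => hβ z ⟨hαr.trans hz.1, hz.2⟩
    have hAo : IsOpen (φ '' A) := hpre.isOpen_image hJ (isOpen_sq_norm_mem_Ioo _ _) hAN
    have hAne : (φ '' A).Nonempty := by
      obtain ⟨τ, h1, h2⟩ := exists_between hrβ
      obtain ⟨z, hz⟩ := exists_norm_eq (R2n n) (Real.sqrt_nonneg τ)
      refine ⟨φ z, z, ?_, rfl⟩
      change ‖z‖ ^ 2 ∈ Ioo (r ^ 2) β
      rw [hz, Real.sq_sqrt ((sq_nonneg r).trans h1.le)]
      exact ⟨h1, h2⟩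
    have hAU : φ '' A ⊆ ball (0 : R2n n) 1 \ closedBall 0 (1 - ε) :=
      (hφ.2.2.2.1.mono_left hAN).image_subset
    have hfin : volume (ball (0 : R2n n) 1 \ closedBall 0 (1 - ε)) ≠ ⊤ :=
      measure_ne_top_of_subset sdiff_subset measure_ball_lt_top.ne
    have hApos : 0 < volume.real (φ '' A) :=
      ENNReal.toReal_pos (hAo.measure_pos volume hAne).ne' (measure_ne_top_of_subset hAU hfin)
    have hsum : volume.real (φ '' A) + volume.real D ≤
        volume.real (ball (0 : R2n n) 1 \ closedBall 0 (1 - ε)) := by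
      rw [← measureReal_union hout hDo.measurableSet (measure_ne_top_of_subset hAU hfin)
        (measure_ne_top_of_subset hsub hfin)]
      exact measureReal_mono (union_subset hAU hsub) hfin
    have hcb : volume.real (closedBall (0 : R2n n) (1 - ε)) = (1 - ε) ^ (2 * n) * V := by
      have h1ε : 0 ≤ 1 - ε := by linarith [hε.2]
      rw [measureReal_def, Measure.addHaar_closedBall volume 0 h1ε, ENNReal.toReal_mul,
        ENNReal.toReal_ofReal (by positivity), hdim]
      rfl
    rw [measureReal_sdiff (closedBall_subset_ball (by linarith [hε.1])) measurableSet_closedBall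
      measure_ball_lt_top.ne, hcb] at hsum
    have hlt : (r ^ 2) ^ n < 1 - (1 - ε) ^ (2 * n) := by
      rw [← pow_mul]
      refine lt_of_mul_lt_mul_right ?_ hVpos.le
      linarith
    have hn0 : n ≠ 0 := by omega
    calc r ^ 2 = ((r ^ 2) ^ n) ^ ((1 : ℝ) / n) := by
          rw [one_div, Real.pow_rpow_inv_natCast (sq_nonneg r) hn0]
      _ < (1 - (1 - ε) ^ (2 * n)) ^ ((1 : ℝ) / n) :=
          Real.rpow_lt_rpow (by positivity) hlt (by positivity)
  · exact (false_of_outer_side hJ hE hpre hinj hr hαr hrβ hβ hbd hDf hout hin).elim
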